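/- arXiv:1810.07432 — 2 statements merged into one kernel-verified Lean document; each statement's English description precedes it below -/
import Mathlib

section
/- Let Θ be a real n×m matrix and L_Θ = {(x, Θx) : x ∈ ℝ^m} ⊂ ℝ^{m+n}. Then the Diophantine exponents coincide: ω(L_Θ) = ω(Θ), where ω(Θ) = sup{τ ∈ ℝ : liminf_{t→∞} t^τ ψ_Θ(t) < ∞} and ω(L_Θ) = sup{γ ∈ ℝ : liminf_{t→∞} t^γ ψ_{L_Θ}(t) < ∞}. -/
open MeasureTheory Filter

noncomputable section

/-- The sup-norm of a vector in Euclidean space. -/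
def supNorm {d : ℕ} (w : EuclideanSpace ℝ (Fin d)) : ℝ := ⨆ i, |w i|

/-- The point of `ℝ^d` (with Euclidean metric) corresponding to an integer vector. -/
def intVec {d : ℕ} (z : Fin d → ℤ) : EuclideanSpace ℝ (Fin d) :=
  (WithLp.equiv 2 (Fin d → ℝ)).symm (fun i => (z i : ℝ))

/-- The irrationality measure function `ψ_B` of a linear subspace of `ℝ^d`:
`ψ_B(t) = inf { dist(z, B) : z ∈ ℤ^d, 1 ≤ |z| < t }`. -/
def psiSub {d : ℕ} (B : Submodule ℝ (EuclideanSpace ℝ (Fin d))) (t : ℝ) : ℝ :=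
  sInf ((fun z : Fin d → ℤ =>
      Metric.infDist (intVec z) (B : Set (EuclideanSpace ℝ (Fin d)))) ''
    {z | 1 ≤ supNorm (intVec z) ∧ supNorm (intVec z) < t})

/-- The Diophantine exponent of a linear subspace of `ℝ^d`:
`ω(B) = sup { γ : liminf_{t→∞} t^γ ψ_B(t) < ∞ }`, as an extended real number. -/
def diophExp {d : ℕ} (B : Submodule ℝ (EuclideanSpace ℝ (Fin d))) : EReal :=
  sSup {x : EReal | ∃ γ : ℝ, x = (γ : EReal) ∧
    Filter.liminf (fun t : ℝ => ENNReal.ofReal (t ^ γ * psiSub B t)) Filter.atTop < ⊤}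

/-- The graph subspace `C(Θ)` of an `(a-c)×c` matrix `Θ`, relative to an orthonormal
basis `e` of an `a`-dimensional subspace of `ℝ^d`:
`C(Θ) = { ∑ x_j e_j + ∑_i (∑_j θ_{ij} x_j) e_{c+i} : x ∈ ℝ^c }`. -/
def graphSub (d a c : ℕ) (hca : c ≤ a) (e : Fin a → EuclideanSpace ℝ (Fin d))
    (Θ : Fin (a - c) → Fin c → ℝ) : Submodule ℝ (EuclideanSpace ℝ (Fin d)) :=
  Submodule.span ℝ {v | ∃ x : Fin c → ℝ,
    v = (∑ j : Fin c, x j • e (Fin.castLE hca j)) +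
        ∑ i : Fin (a - c), (∑ j : Fin c, Θ i j * x j) • e ⟨c + i.1, by have := i.2; omega⟩}

/-- Distance from a real number to the nearest integer. -/
def distToInt (ξ : ℝ) : ℝ := |ξ - round ξ|

/-- The irrationality measure function `ψ_Θ` of an `n×m` real matrix `Θ`:
`ψ_Θ(t) = min { max_j ‖Σ_i θ_{ji} x_i‖ : x ∈ ℤ^m, 0 < |x| ≤ t }`. -/
def psiMat {m n : ℕ} (Θ : Fin n → Fin m → ℝ) (t : ℝ) : ℝ :=
  sInf ((fun x : Fin m → ℤ =>
      ⨆ j : Fin n, distToInt (∑ i : Fin m, Θ j i * (x i : ℝ))) ''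
    {x | x ≠ 0 ∧ (⨆ i : Fin m, |(x i : ℝ)|) ≤ t})

/-- The graph subspace `L_Θ = {(x, Θx) : x ∈ ℝ^m} ⊆ ℝ^{m+n}` of an `n×m` matrix `Θ`. -/
def matGraph {m n : ℕ} (Θ : Fin n → Fin m → ℝ) :
    Submodule ℝ (EuclideanSpace ℝ (Fin (m + n))) :=
  Submodule.span ℝ {w | ∃ x : Fin m → ℝ,
    w = (WithLp.equiv 2 (Fin (m + n) → ℝ)).symm
      (fun k => Fin.addCases (fun i => x i) (fun j => ∑ i : Fin m, Θ j i * x i) k)}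

/-- The Diophantine exponent of an `n×m` real matrix `Θ`:
`ω(Θ) = sup { τ : liminf_{t→∞} t^τ ψ_Θ(t) < ∞ }`, as an extended real number. -/
def diophExpMat {m n : ℕ} (Θ : Fin n → Fin m → ℝ) : EReal :=
  sSup {x : EReal | ∃ τ : ℝ, x = (τ : EReal) ∧
    Filter.liminf (fun t : ℝ => ENNReal.ofReal (t ^ τ * psiMat Θ t)) Filter.atTop < ⊤}

/-- A `liminf` of truncated reals is finite iff the function is frequently bounded. -/
lemma liminf_ofReal_lt_top_iff {ι : Type*} {l : Filter ι} (g : ι → ℝ) :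
    liminf (fun t => ENNReal.ofReal (g t)) l < ⊤ ↔ ∃ M : ℝ, ∃ᶠ t in l, g t ≤ M := by
  constructor
  · intro h
    obtain ⟨M, hM, hMtop⟩ := exists_between h
    refine ⟨M.toReal, (frequently_lt_of_liminf_lt (by isBoundedDefault) hM).mono ?_⟩
    intro t ht
    exact (ENNReal.ofReal_le_iff_le_toReal hMtop.ne).1 ht.le
  · rintro ⟨M, hM⟩
    refine lt_of_le_of_lt (liminf_le_of_frequently_le
      (hM.mono fun t ht => ENNReal.ofReal_le_ofReal ht) (by isBoundedDefault))
      ENNReal.ofReal_lt_top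

lemma mem_matGraph_of_vector {m n : ℕ} (Θ : Fin n → Fin m → ℝ) (x : Fin m → ℝ) :
    (WithLp.equiv 2 (Fin (m + n) → ℝ)).symm
      (fun k => Fin.addCases (fun i => x i) (fun j => ∑ i : Fin m, Θ j i * x i) k)
      ∈ matGraph Θ :=
  Submodule.subset_span ⟨x, rfl⟩

lemma apply_natAdd_of_mem_matGraph {m n : ℕ} {Θ : Fin n → Fin m → ℝ}
    {w : EuclideanSpace ℝ (Fin (m + n))} (hw : w ∈ matGraph Θ) (j : Fin n) :
    w (Fin.natAdd m j) = ∑ i, Θ j i * w (Fin.castAdd n i) := by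
  unfold matGraph at hw
  induction hw using Submodule.span_induction with
  | mem w h =>
    obtain ⟨x, rfl⟩ := h
    simp
  | zero => simp
  | add u v _ _ hu hv => simp [hu, hv, mul_add, Finset.sum_add_distrib]
  | smul a u _ hu =>
    simp only [PiLp.smul_apply, smul_eq_mul, hu, Finset.mul_sum]
    exact Finset.sum_congr rfl fun i _ => by ring

lemma euclidean_norm_le_card_mul {d : ℕ} (w : EuclideanSpace ℝ (Fin d)) {M : ℝ} (hM : 0 ≤ M)
    (h : ∀ i, |w i| ≤ M) : ‖w‖ ≤ d * M := by
  rw [EuclideanSpace.norm_eq]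
  apply Real.sqrt_le_iff.2 ⟨by positivity, ?_⟩
  calc ∑ i, ‖w i‖ ^ 2 ≤ ∑ _i : Fin d, M ^ 2 :=
        Finset.sum_le_sum fun i _ => pow_le_pow_left₀ (norm_nonneg _) (h i) 2
    _ = d * M ^ 2 := by simp
    _ ≤ (d * M) ^ 2 := by
        have : (d : ℝ) ≤ (d : ℝ) ^ 2 := by exact_mod_cast Nat.le_self_pow two_ne_zero d
        rw [mul_pow]
        gcongr

lemma abs_apply_le_norm {d : ℕ} (w : EuclideanSpace ℝ (Fin d)) (i : Fin d) : |w i| ≤ ‖w‖ :=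
  PiLp.norm_apply_le w i

/-- One plus the sum of the absolute values of the entries of a matrix. -/
def entrySum {m n : ℕ} (Θ : Fin n → Fin m → ℝ) : ℝ := 1 + ∑ j, ∑ i, |Θ j i|

lemma one_add_row_le_entrySum {m n : ℕ} (Θ : Fin n → Fin m → ℝ) (j : Fin n) :
    1 + ∑ i, |Θ j i| ≤ entrySum Θ := by
  have := Finset.single_le_sum (f := fun j => ∑ i, |Θ j i|)
    (fun j _ => Finset.sum_nonneg fun i _ => abs_nonneg _) (Finset.mem_univ j)
  unfold entrySum
  linarith

lemma one_le_entrySum {m n : ℕ} (Θ : Fin n → Fin m → ℝ) : 1 ≤ entrySum Θ := by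
  have : 0 ≤ ∑ j, ∑ i, |Θ j i| := by positivity
  unfold entrySum
  linarith

lemma abs_row_le {m : ℕ} (r x : Fin m → ℝ) {M : ℝ} (h : ∀ i, |x i| ≤ M) :
    |∑ i, r i * x i| ≤ (∑ i, |r i|) * M := by
  rw [Finset.sum_mul]
  refine (Finset.abs_sum_le_sum_abs _ _).trans (Finset.sum_le_sum fun i _ => ?_)
  rw [abs_mul]
  exact mul_le_mul_of_nonneg_left (h i) (abs_nonneg _)

lemma abs_row_sub_le_infDist {m n : ℕ} (Θ : Fin n → Fin m → ℝ)
    (z : EuclideanSpace ℝ (Fin (m + n))) (j : Fin n) :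
    |∑ i, Θ j i * z (Fin.castAdd n i) - z (Fin.natAdd m j)| ≤
      entrySum Θ * Metric.infDist z (matGraph Θ : Set (EuclideanSpace ℝ (Fin (m + n)))) := by
  have hC : 0 < entrySum Θ := by linarith [one_le_entrySum Θ]
  rw [← div_le_iff₀' hC, Metric.le_infDist ⟨0, (matGraph Θ).zero_mem⟩]
  intro p hp
  rw [div_le_iff₀' hC, dist_eq_norm]
  have hp' := apply_natAdd_of_mem_matGraph hp j
  have hz : ∑ i, Θ j i * z (Fin.castAdd n i) - z (Fin.natAdd m j) =
      ∑ i, Θ j i * (z - p) (Fin.castAdd n i) - (z - p) (Fin.natAdd m j) := by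
    simp only [PiLp.sub_apply, mul_sub, Finset.sum_sub_distrib, hp']
    ring
  rw [hz]
  have h1 := abs_row_le (Θ j) (fun i => (z - p) (Fin.castAdd n i))
    (fun i => abs_apply_le_norm (z - p) _)
  have h2 := abs_apply_le_norm (z - p) (Fin.natAdd m j)
  have h3 := mul_le_mul_of_nonneg_right (one_add_row_le_entrySum Θ j) (norm_nonneg (z - p))
  have h4 := abs_sub (∑ i, Θ j i * (z - p) (Fin.castAdd n i)) ((z - p) (Fin.natAdd m j))
  linarith

lemma intVec_apply {d : ℕ} (z : Fin d → ℤ) (i : Fin d) : intVec z i = z i := rfl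

lemma abs_le_supNorm {d : ℕ} (w : EuclideanSpace ℝ (Fin d)) (i : Fin d) : |w i| ≤ supNorm w :=
  le_ciSup (f := fun i => |w i|) (Set.finite_range _).bddAbove i

lemma bddBelow_psiMat_image {m n : ℕ} (Θ : Fin n → Fin m → ℝ) (s : Set (Fin m → ℤ)) :
    BddBelow ((fun x : Fin m → ℤ =>
      ⨆ j : Fin n, distToInt (∑ i : Fin m, Θ j i * (x i : ℝ))) '' s) := by
  refine ⟨0, ?_⟩
  rintro _ ⟨x, -, rfl⟩
  exact Real.iSup_nonneg fun j => abs_nonneg _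

lemma psiMat_le {m n : ℕ} (Θ : Fin n → Fin m → ℝ) {t M : ℝ} {x : Fin m → ℤ} (hx : x ≠ 0)
    (hxt : ∀ i, |(x i : ℝ)| ≤ t) (ht : 0 ≤ t) (hM : 0 ≤ M)
    (h : ∀ j, distToInt (∑ i, Θ j i * (x i : ℝ)) ≤ M) : psiMat Θ t ≤ M := by
  refine le_trans (csInf_le (bddBelow_psiMat_image Θ _) ⟨x, ⟨hx, ?_⟩, rfl⟩) (Real.iSup_le h hM)
  exact Real.iSup_le hxt ht

lemma psiMat_le_half {m n : ℕ} (hm : 1 ≤ m) (Θ : Fin n → Fin m → ℝ) {t : ℝ} (ht : 1 ≤ t) :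
    psiMat Θ t ≤ 1 / 2 := by
  refine psiMat_le Θ (x := fun _ => 1) ?_ ?_ (by linarith) (by norm_num) fun j => abs_sub_round _
  · intro h
    simpa using congrFun h ⟨0, hm⟩
  · simpa using fun _ => ht

lemma psiMat_le_entrySum_mul_psiSub {m n : ℕ} (hm : 1 ≤ m) (Θ : Fin n → Fin m → ℝ) {t : ℝ}
    (ht : 1 < t) : psiMat Θ t ≤ entrySum Θ * psiSub (matGraph Θ) t := by
  have hC : 0 < entrySum Θ := by linarith [one_le_entrySum Θ]
  rw [← div_le_iff₀' hC]
  apply le_csInf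
  · refine Set.Nonempty.image _ ⟨fun _ => 1, ?_⟩
    have : Nonempty (Fin (m + n)) := ⟨⟨0, by omega⟩⟩
    simp [supNorm, intVec_apply, ht]
  · rintro _ ⟨z, ⟨hz1, hzt⟩, rfl⟩
    rw [div_le_iff₀' hC]
    have key := fun j => abs_row_sub_le_infDist Θ (intVec z) j
    simp only [intVec_apply] at key
    set D := Metric.infDist (intVec z) (matGraph Θ : Set (EuclideanSpace ℝ (Fin (m + n))))
    have hD : 0 ≤ entrySum Θ * D := mul_nonneg hC.le Metric.infDist_nonneg
    by_cases hx : (fun i => z (Fin.castAdd n i)) = 0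
    · have hx' : ∀ i, z (Fin.castAdd n i) = 0 := congrFun hx
      obtain ⟨j, hj⟩ : ∃ j, z (Fin.natAdd m j) ≠ 0 := by
        by_contra! hy
        have : z = 0 := by
          funext k
          induction k using Fin.addCases with
          | left i => exact hx' i
          | right j => exact hy j
        subst this
        simp [supNorm, intVec_apply] at hz1
        linarith
      have hkey := key j
      simp only [hx', Int.cast_zero, mul_zero, Finset.sum_const_zero, zero_sub, abs_neg] at hkey
      have : (1 : ℝ) ≤ |(z (Fin.natAdd m j) : ℝ)| := by
        exact_mod_cast Int.one_le_abs hj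
      linarith [psiMat_le_half hm Θ ht.le]
    · exact psiMat_le Θ hx (fun i => (abs_le_supNorm (intVec z) _).trans hzt.le)
        (by linarith) hD fun j => (round_le _ _).trans (key j)

lemma psiSub_le_mul_psiMat {m n : ℕ} (hm : 1 ≤ m) (Θ : Fin n → Fin m → ℝ) {t : ℝ}
    (ht : 1 ≤ t) :
    psiSub (matGraph Θ) ((entrySum Θ + 1) * t) ≤ ((m + n : ℕ) : ℝ) * psiMat Θ t := by
  have hd : (0 : ℝ) < ((m + n : ℕ) : ℝ) := by exact_mod_cast (by omega : 0 < m + n)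
  rw [← div_le_iff₀' hd]
  apply le_csInf
  · refine Set.Nonempty.image _ ⟨fun _ => 1, fun h => ?_, ?_⟩
    · simpa using congrFun h ⟨0, hm⟩
    · exact Real.iSup_le (by simpa using fun _ => ht) (by linarith)
  · rintro _ ⟨x, ⟨hx0, hxt⟩, rfl⟩
    rw [div_le_iff₀' hd]
    have hxi : ∀ i, |(x i : ℝ)| ≤ t := fun i =>
      (le_ciSup (f := fun i => |(x i : ℝ)|) (Set.finite_range _).bddAbove i).trans hxt
    obtain ⟨S, hS⟩ : ∃ S, S = ⨆ j : Fin n, distToInt (∑ i : Fin m, Θ j i * (x i : ℝ)) := ⟨_, rfl⟩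
    simp only [← hS]
    have hS0 : 0 ≤ S := hS ▸ Real.iSup_nonneg fun j => abs_nonneg _
    have hSj : ∀ j, distToInt (∑ i : Fin m, Θ j i * (x i : ℝ)) ≤ S := fun j => hS ▸
      le_ciSup (f := fun j => distToInt (∑ i : Fin m, Θ j i * (x i : ℝ)))
        (Set.finite_range _).bddAbove j
    let z : Fin (m + n) → ℤ :=
      Fin.append x (fun j => round (∑ i : Fin m, Θ j i * (x i : ℝ)))
    have hzl : ∀ i, z (Fin.castAdd n i) = x i := Fin.append_left _ _
    have hzr : ∀ j, z (Fin.natAdd m j) = round (∑ i : Fin m, Θ j i * (x i : ℝ)) :=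
      Fin.append_right _ _
    have hC1 := one_le_entrySum Θ
    have hz : psiSub (matGraph Θ) ((entrySum Θ + 1) * t) ≤ Metric.infDist (intVec z)
        (matGraph Θ : Set (EuclideanSpace ℝ (Fin (m + n)))) := by
      refine csInf_le ⟨0, ?_⟩ (Set.mem_image_of_mem _ ⟨?_, ?_⟩)
      · rintro _ ⟨z, -, rfl⟩
        exact Metric.infDist_nonneg
      · obtain ⟨i, hi⟩ := Function.ne_iff.1 hx0
        refine le_trans ?_ (abs_le_supNorm (intVec z) (Fin.castAdd n i))
        rw [intVec_apply, hzl, ← Int.cast_abs]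
        exact_mod_cast Int.one_le_abs hi
      · have hb : supNorm (intVec z) ≤ entrySum Θ * t + 1 / 2 := by
          refine Real.iSup_le (fun k => ?_) (by positivity)
          rw [intVec_apply]
          induction k using Fin.addCases with
          | left i =>
            rw [hzl]
            nlinarith [hxi i]
          | right j =>
            rw [hzr]
            have h1 := abs_row_le (Θ j) _ hxi
            have h2 := abs_sub_round (∑ i : Fin m, Θ j i * (x i : ℝ))
            have h3 := one_add_row_le_entrySum Θ j
            have h4 := abs_sub_abs_le_abs_sub
              (round (∑ i : Fin m, Θ j i * (x i : ℝ)) : ℝ) (∑ i : Fin m, Θ j i * (x i : ℝ))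
            rw [abs_sub_comm] at h4
            nlinarith
        nlinarith
    refine hz.trans ((Metric.infDist_le_dist_of_mem
      (mem_matGraph_of_vector Θ fun i => (x i : ℝ))).trans ?_)
    rw [dist_eq_norm]
    refine euclidean_norm_le_card_mul _ hS0 fun k => ?_
    rw [PiLp.sub_apply, intVec_apply]
    induction k using Fin.addCases with
    | left i => simpa [hzl] using hS0
    | right j =>
      rw [abs_sub_comm]
      simpa [hzr, distToInt] using hSj j

/-- for a real `n×m` matrix `Θ` and its graph `L_Θ ⊆ ℝ^{m+n}`, the Diophantine
exponents coincide: `ω(L_Θ) = ω(Θ)`. -/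
theorem stmt_8 (m n : ℕ) (hm : 1 ≤ m) (hn : 1 ≤ n) (Θ : Fin n → Fin m → ℝ) :
    diophExp (matGraph Θ) = diophExpMat Θ := by
  have hC1 := one_le_entrySum Θ
  unfold diophExp diophExpMat
  congr 1
  ext e
  refine exists_congr fun γ => and_congr_right fun _ => ?_
  rw [liminf_ofReal_lt_top_iff, liminf_ofReal_lt_top_iff]
  constructor
  · rintro ⟨M, hM⟩
    refine ⟨entrySum Θ * M, (hM.and_eventually (eventually_gt_atTop 1)).mono ?_⟩
    rintro t ⟨hMt, ht⟩
    calc t ^ γ * psiMat Θ t ≤ t ^ γ * (entrySum Θ * psiSub (matGraph Θ) t) :=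
          mul_le_mul_of_nonneg_left (psiMat_le_entrySum_mul_psiSub hm Θ ht)
            (Real.rpow_nonneg (by linarith) γ)
      _ = entrySum Θ * (t ^ γ * psiSub (matGraph Θ) t) := by ring
      _ ≤ entrySum Θ * M := mul_le_mul_of_nonneg_left hMt (by linarith)
  · rintro ⟨M, hM⟩
    have hK : 0 < entrySum Θ + 1 := by linarith
    refine ⟨(entrySum Θ + 1) ^ γ * ((m + n : ℕ) : ℝ) * M,
      (tendsto_id.const_mul_atTop hK).frequently
        ((hM.and_eventually (eventually_ge_atTop 1)).mono ?_)⟩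
    rintro t ⟨hMt, ht⟩
    have hKγ : 0 ≤ (entrySum Θ + 1) ^ γ := Real.rpow_nonneg hK.le γ
    have ht0 : 0 ≤ t := by linarith
    simp only [id_eq]
    calc ((entrySum Θ + 1) * t) ^ γ * psiSub (matGraph Θ) ((entrySum Θ + 1) * t)
        ≤ ((entrySum Θ + 1) * t) ^ γ * (((m + n : ℕ) : ℝ) * psiMat Θ t) :=
          mul_le_mul_of_nonneg_left (psiSub_le_mul_psiMat hm Θ ht)
            (Real.rpow_nonneg (by positivity) γ)
      _ = (entrySum Θ + 1) ^ γ * ((m + n : ℕ) : ℝ) * (t ^ γ * psiMat Θ t) := by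
          rw [Real.mul_rpow hK.le ht0]
          ring
      _ ≤ (entrySum Θ + 1) ^ γ * ((m + n : ℕ) : ℝ) * M :=
          mul_le_mul_of_nonneg_left hMt (by positivity)

end
end

section
/- Let 1 ≤ b ≤ c < a ≤ d be integers and β, γ, B₀, C₀ real numbers with 0 < β ≤ γ. Define ψ(T) = T^{−β}(log(T+2))^{B₀} and φ(T) = T^{−γ}(log(T+2))^{C₀} for T ≥ 1, and define μ_T, M_T, λ_T as in the context. If either γ(a−c) > β(a−b) + c − b, or γ(a−c) = β(a−b) + c − b and C₀(a−c) − B₀(a−b) < −1, then the series Σ_{T=1}^∞ λ_T · φ(T)^{a−c}/T^{a−c} converges. -/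
open MeasureTheory Filter

noncomputable section

/-- `μ_T = (T/ψ(T))^{a−b} · max{1, (φ(T)/ψ(T))^{d−a}}` for `T ≥ 1`, and `μ_T = 0` for `T < 1`. -/
def muF (a b d : ℕ) (ψ φ : ℝ → ℝ) (T : ℝ) : ℝ :=
  if T < 1 then 0 else (T / ψ T) ^ (a - b) * max 1 ((φ T / ψ T) ^ (d - a))

/-- `M_T = Σ_{j=0}^{⌊log₂ T⌋} μ_{T/2^j}` for integers `T ≥ 1` (and `M_0 = 0`). -/
def MF (a b d : ℕ) (ψ φ : ℝ → ℝ) (T : ℕ) : ℝ :=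
  ∑ j ∈ Finset.range (Nat.log 2 T + 1), muF a b d ψ φ ((T : ℝ) / 2 ^ j)

/-- `λ_T = M_T − M_{T−1}` for integers `T ≥ 1`. -/
def lamF (a b d : ℕ) (ψ φ : ℝ → ℝ) (T : ℕ) : ℝ :=
  MF a b d ψ φ T - MF a b d ψ φ (T - 1)

lemma one_le_log_add_two {t : ℝ} (ht : 1 ≤ t) : 1 ≤ Real.log (t + 2) := by
  rw [Real.le_log_iff_exp_le (by linarith)]
  linarith [Real.exp_one_lt_d9]

lemma rpow_le_mul_rpow_of_comparable {u v k : ℝ} (hu : 0 < u) (hv : 0 < v) (hk : 1 ≤ k)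
    (huv : u ≤ k * v) (hvu : v ≤ k * u) (e : ℝ) : u ^ e ≤ k ^ |e| * v ^ e := by
  have hk0 : 0 < k := by linarith
  rcases le_total 0 e with he | he
  · rw [abs_of_nonneg he, ← Real.mul_rpow hk0.le hv.le]
    exact Real.rpow_le_rpow hu.le huv he
  · have h : (k * u) ^ e ≤ v ^ e := Real.rpow_le_rpow_of_nonpos hv hvu he
    rw [Real.mul_rpow hk0.le hu.le] at h
    calc u ^ e = k ^ |e| * (k ^ e * u ^ e) := by
          rw [← mul_assoc, ← Real.rpow_add hk0, abs_of_nonpos he]; simp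
      _ ≤ _ := by gcongr

lemma log_add_two_rpow_le {x y : ℝ} (j : ℕ) (hy : 1 ≤ y) (hyx : y ≤ x) (hxy : x ≤ 2 ^ j * y)
    (e : ℝ) : Real.log (y + 2) ^ e ≤ ((j : ℝ) + 1) ^ |e| * Real.log (x + 2) ^ e := by
  have hLy := one_le_log_add_two hy
  have hLx := one_le_log_add_two (hy.trans hyx)
  have hj : (0 : ℝ) ≤ j := j.cast_nonneg
  have hle : Real.log (y + 2) ≤ Real.log (x + 2) := Real.log_le_log (by linarith) (by linarith)
  have h2 : (1 : ℝ) ≤ 2 ^ j := one_le_pow₀ (by norm_num)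
  have hub : Real.log (x + 2) ≤ j * Real.log 2 + Real.log (y + 2) := by
    rw [← Real.log_pow, ← Real.log_mul (by positivity) (by positivity)]
    exact Real.log_le_log (by linarith) (by nlinarith)
  have hlog2 : Real.log 2 ≤ 1 := by linarith [Real.log_two_lt_d9]
  exact rpow_le_mul_rpow_of_comparable (by linarith) (by linarith) (by linarith)
    (by nlinarith) (by nlinarith) e

lemma isLittleO_log_add_two_rpow (v : ℝ) {ε : ℝ} (hε : 0 < ε) :
    (fun t : ℝ => Real.log (t + 2) ^ v) =o[atTop] fun t : ℝ => t ^ ε := by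
  refine ((isLittleO_log_rpow_rpow_atTop v hε).comp_tendsto
    (tendsto_atTop_add_const_right atTop (2 : ℝ) tendsto_id)).trans_isBigO ?_
  refine Asymptotics.IsBigO.of_bound (3 ^ ε) ?_
  filter_upwards [eventually_ge_atTop (1 : ℝ)] with t ht
  simp only [Function.comp, id]
  rw [Real.norm_of_nonneg (by positivity), Real.norm_of_nonneg (by positivity),
    ← Real.mul_rpow (by norm_num) (by linarith)]
  exact Real.rpow_le_rpow (by linarith) (by linarith) hε.le

lemma summable_rpow_mul_log_add_two_rpow {u v : ℝ} (h : u < -1 ∨ u = -1 ∧ v < -1) :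
    Summable fun n : ℕ => (n : ℝ) ^ u * Real.log ((n : ℝ) + 2) ^ v := by
  rcases h with hu | ⟨rfl, hv⟩
  · obtain ⟨ε, hε, huε⟩ : ∃ ε > 0, u + ε < -1 := ⟨(-1 - u) / 2, by linarith, by linarith⟩
    refine summable_of_isBigO_nat (Real.summable_nat_rpow.2 huε) ?_
    have h1 := ((Asymptotics.isBigO_refl (fun t : ℝ => t ^ u) atTop).mul
      (isLittleO_log_add_two_rpow v hε).isBigO).comp_tendsto
        (tendsto_natCast_atTop_atTop (R := ℝ))
    refine h1.congr' (by rfl) ?_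
    filter_upwards [eventually_gt_atTop 0] with n hn
    have : (0 : ℝ) < n := by exact_mod_cast hn
    simp [Real.rpow_add this]
  · refine (summable_condensed_iff_of_nonneg (fun n => ?_) fun m n hm hmn => ?_).1 ?_
    · have : 0 ≤ Real.log ((n : ℝ) + 2) := Real.log_nonneg (by linarith [n.cast_nonneg (α := ℝ)])
      positivity
    · have hm' : (1 : ℝ) ≤ m := by exact_mod_cast hm
      have hmn' : (m : ℝ) ≤ n := by exact_mod_cast hmn
      have hL := one_le_log_add_two hm'
      have hL' : Real.log ((m : ℝ) + 2) ≤ Real.log ((n : ℝ) + 2) :=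
        Real.log_le_log (by linarith) (by linarith)
      exact mul_le_mul (Real.rpow_le_rpow_of_nonpos (by linarith) hmn' (by norm_num))
        (Real.rpow_le_rpow_of_nonpos (by linarith) hL' (by linarith))
        (Real.rpow_nonneg (by linarith) _) (by positivity)
    · have hs : Summable fun k : ℕ => Real.log 2 ^ v * (k : ℝ) ^ v :=
        (Real.summable_nat_rpow.2 hv).mul_left _
      refine summable_of_isBigO_nat hs (Asymptotics.IsBigO.of_bound 1 ?_)
      filter_upwards [eventually_gt_atTop 0] with k hk
      have hk' : (0 : ℝ) < k := by exact_mod_cast hk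
      have hl2 : 0 < Real.log 2 := Real.log_pos (by norm_num)
      have hL := one_le_log_add_two (one_le_pow₀ (by norm_num) : (1 : ℝ) ≤ 2 ^ k)
      have hlow : Real.log 2 * k ≤ Real.log (2 ^ k + 2) := by
        rw [mul_comm, ← Real.log_pow]
        exact Real.log_le_log (by positivity) (by linarith)
      push_cast
      rw [Real.rpow_neg_one, mul_inv_cancel_left₀ (by positivity), one_mul,
        ← Real.mul_rpow hl2.le hk'.le, Real.norm_of_nonneg (by positivity),
        Real.norm_of_nonneg (by positivity)]
      exact Real.rpow_le_rpow_of_nonpos (by positivity) hlow (by linarith)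

lemma abs_rpow_mul_log_sub_le {s e x y : ℝ} (hs : 1 ≤ s) (hy : 1 ≤ y) (hyx : y ≤ x)
    (hxy : x ≤ 2 * y) :
    |x ^ s * Real.log (x + 2) ^ e - y ^ s * Real.log (y + 2) ^ e| ≤
      (s + |e|) * 2 ^ |e| * (x ^ (s - 1) * Real.log (x + 2) ^ e) * (x - y) := by
  have key := Convex.norm_image_sub_le_of_norm_hasDerivWithin_le (𝕜 := ℝ)
    (f := fun t : ℝ => t ^ s * Real.log (t + 2) ^ e)
    (f' := fun t : ℝ => s * t ^ (s - 1) * Real.log (t + 2) ^ e +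
      t ^ s * (1 / (t + 2) * e * Real.log (t + 2) ^ (e - 1)))
    (s := Set.Icc y x) (C := (s + |e|) * 2 ^ |e| * (x ^ (s - 1) * Real.log (x + 2) ^ e))
    (fun t ht => ?_) (fun t ht => ?_) (convex_Icc y x)
    (Set.left_mem_Icc.2 hyx) (Set.right_mem_Icc.2 hyx)
  · simpa [Real.norm_eq_abs, abs_of_nonneg (sub_nonneg.2 hyx)] using key
  · have ht1 : 1 ≤ t := hy.trans ht.1
    have hL := one_le_log_add_two ht1
    refine HasDerivAt.hasDerivWithinAt (HasDerivAt.mul ?_ ?_)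
    · exact Real.hasDerivAt_rpow_const (Or.inl (by linarith))
    · exact (((hasDerivAt_id t).add_const 2).log (by simp only [id]; positivity)).rpow_const
        (Or.inl (zero_lt_one.trans_le hL).ne')
  · have ht1 : 1 ≤ t := hy.trans ht.1
    have ht0 : 0 < t := by linarith
    have hL := one_le_log_add_two ht1
    have hL0 : 0 < Real.log (t + 2) := by linarith
    have hLx := one_le_log_add_two (hy.trans hyx)
    have hcomp := log_add_two_rpow_le 1 ht1 ht.2 (by linarith [ht.1]) e
    norm_num at hcomp
    have hx0 : 0 < x := ht0.trans_le ht.2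
    have hpow : t ^ (s - 1) ≤ x ^ (s - 1) := Real.rpow_le_rpow ht0.le ht.2 (by linarith)
    have h1 : ‖t ^ s * (1 / (t + 2) * e * Real.log (t + 2) ^ (e - 1))‖ ≤
        |e| * (t ^ (s - 1) * Real.log (t + 2) ^ e) := by
      have e1 : t ^ s * (1 / (t + 2) * e * Real.log (t + 2) ^ (e - 1)) =
          e * (t ^ (s - 1) * Real.log (t + 2) ^ e) * (t / ((t + 2) * Real.log (t + 2))) := by
        rw [Real.rpow_sub_one ht0.ne', Real.rpow_sub_one hL0.ne']
        field_simp
      rw [e1, norm_mul, norm_mul, Real.norm_eq_abs e]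
      have h2 : ‖t / ((t + 2) * Real.log (t + 2))‖ ≤ 1 := by
        rw [Real.norm_of_nonneg (by positivity), div_le_one (by positivity)]
        nlinarith
      rw [Real.norm_of_nonneg (by positivity)]
      exact mul_le_of_le_one_right (by positivity) h2
    calc _ ≤ s * t ^ (s - 1) * Real.log (t + 2) ^ e +
          |e| * (t ^ (s - 1) * Real.log (t + 2) ^ e) := by
          refine (norm_add_le _ _).trans (add_le_add ?_ h1)
          rw [Real.norm_of_nonneg (by positivity)]
      _ = (s + |e|) * (t ^ (s - 1) * Real.log (t + 2) ^ e) := by ring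
      _ ≤ (s + |e|) * (x ^ (s - 1) * (2 ^ |e| * Real.log (x + 2) ^ e)) := by gcongr
      _ = _ := by ring

lemma summable_add_one_rpow_mul_half_pow (v : ℝ) :
    Summable fun j : ℕ => ((j : ℝ) + 1) ^ v * (1 / 2) ^ j := by
  obtain ⟨m, hm⟩ := exists_nat_ge v
  have h := (summable_nat_add_iff 1).2
    (summable_pow_mul_geometric_of_norm_lt_one (R := ℝ) m (r := 1 / 2) (by norm_num))
  refine Summable.of_nonneg_of_le (fun j => by positivity) (fun j => ?_) (h.mul_left 2)
  have h1 : ((j : ℝ) + 1) ^ v ≤ ((j : ℝ) + 1) ^ m := by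
    rw [← Real.rpow_natCast]
    exact Real.rpow_le_rpow_of_exponent_le (by linarith [j.cast_nonneg (α := ℝ)]) hm
  calc _ ≤ ((j : ℝ) + 1) ^ m * (1 / 2) ^ j := by gcongr
    _ = _ := by push_cast; ring

lemma abs_sub_dyadic_le {N : ℝ → ℝ} {s e t₀ D : ℝ} (hs : 1 ≤ s) (ht₀ : 1 ≤ t₀)
    (hN : ∀ t, t₀ ≤ t → N t = t ^ s * Real.log (t + 2) ^ e)
    (hD : ∀ t, t < 2 * t₀ → |N t| ≤ D) {T : ℝ} (hT : 2 ≤ T) (j : ℕ) :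
    |N (T / 2 ^ j) - N ((T - 1) / 2 ^ j)| ≤
      (s + |e|) * 2 ^ |e| * (T ^ (s - 1) * Real.log (T + 2) ^ e) *
        (((j : ℝ) + 1) ^ |e| * (1 / 2) ^ j) + 4 * t₀ * D / T * 2 ^ j := by
  have hLT := one_le_log_add_two (by linarith : 1 ≤ T)
  have h2 : (1 : ℝ) ≤ 2 ^ j := one_le_pow₀ (by norm_num)
  have hD0 : 0 ≤ D := (abs_nonneg _).trans (hD 0 (by linarith))
  have hyx : (T - 1) / 2 ^ j ≤ T / 2 ^ j := by gcongr; linarith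
  have hxy : T / 2 ^ j ≤ 2 * ((T - 1) / 2 ^ j) := by
    rw [← mul_div_assoc]; gcongr; linarith
  rcases le_or_gt t₀ ((T - 1) / 2 ^ j) with hy | hy
  · have hx1 : 1 ≤ T / 2 ^ j := by linarith
    have hxT : T / 2 ^ j ≤ T := div_le_self (by linarith) h2
    rw [hN _ hy, hN _ (hy.trans hyx)]
    refine (abs_rpow_mul_log_sub_le hs (ht₀.trans hy) hyx hxy).trans ?_
    have hpow : (T / 2 ^ j) ^ (s - 1) ≤ T ^ (s - 1) :=
      Real.rpow_le_rpow (by positivity) hxT (by linarith)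
    have hlog := log_add_two_rpow_le j hx1 hxT (mul_div_cancel₀ T (by positivity)).ge e
    have hLx := one_le_log_add_two hx1
    have hsub : T / 2 ^ j - (T - 1) / 2 ^ j = (1 / 2) ^ j := by
      rw [← sub_div]; simp
    rw [hsub]
    calc _ ≤ (s + |e|) * 2 ^ |e| * (T ^ (s - 1) * (((j : ℝ) + 1) ^ |e| *
            Real.log (T + 2) ^ e)) * (1 / 2) ^ j := by gcongr
      _ = (s + |e|) * 2 ^ |e| * (T ^ (s - 1) * Real.log (T + 2) ^ e) *
        (((j : ℝ) + 1) ^ |e| * (1 / 2) ^ j) := by ring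
      _ ≤ _ := le_add_of_nonneg_right (by positivity)
  · have hx : T / 2 ^ j < 2 * t₀ := by linarith
    have h3 : 1 ≤ 2 * t₀ / T * 2 ^ j := by
      rw [div_lt_iff₀ (by positivity)] at hx
      rw [div_mul_eq_mul_div, one_le_div (by positivity)]
      exact hx.le
    calc _ ≤ |N (T / 2 ^ j)| + |N ((T - 1) / 2 ^ j)| := abs_sub _ _
      _ ≤ D + D := add_le_add (hD _ hx) (hD _ (by linarith))
      _ ≤ 2 * D * (2 * t₀ / T * 2 ^ j) := by nlinarith
      _ = 4 * t₀ * D / T * 2 ^ j := by ring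
      _ ≤ _ := le_add_of_nonneg_left (by positivity)

lemma MF_eq_sum_range (a b d : ℕ) (ψ φ : ℝ → ℝ) {T n : ℕ} (hn : Nat.log 2 T ≤ n) :
    MF a b d ψ φ T = ∑ j ∈ Finset.range (n + 1), muF a b d ψ φ ((T : ℝ) / 2 ^ j) := by
  refine Finset.sum_subset (Finset.range_mono (by omega)) fun j _ hj => ?_
  have hlt : T < 2 ^ j := by
    apply Nat.lt_pow_of_log_lt (by norm_num)
    simpa [Nat.lt_succ_iff] using hj
  have hlt' : (T : ℝ) / 2 ^ j < 1 := by
    rw [div_lt_one (by positivity)]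
    exact_mod_cast hlt
  simp [muF, hlt']

lemma exists_abs_lamF_le (a b d : ℕ) (ψ φ : ℝ → ℝ) {s e t₀ D : ℝ} (hs : 1 ≤ s) (ht₀ : 1 ≤ t₀)
    (hN : ∀ t, t₀ ≤ t → muF a b d ψ φ t = t ^ s * Real.log (t + 2) ^ e)
    (hD : ∀ t, t < 2 * t₀ → |muF a b d ψ φ t| ≤ D) :
    ∃ K₁ K₂ : ℝ, ∀ T : ℕ, 2 ≤ T → |lamF a b d ψ φ T| ≤
      K₁ * ((T : ℝ) ^ (s - 1) * Real.log ((T : ℝ) + 2) ^ e) + K₂ := by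
  refine ⟨(s + |e|) * 2 ^ |e| * ∑' j : ℕ, ((j : ℝ) + 1) ^ |e| * (1 / 2) ^ j, 8 * t₀ * D,
    fun T hT => ?_⟩
  have hT' : (2 : ℝ) ≤ T := by exact_mod_cast hT
  have hLT := one_le_log_add_two (by linarith : (1 : ℝ) ≤ T)
  have hD0 : 0 ≤ D := (abs_nonneg _).trans (hD 0 (by linarith))
  have hgeom : ∑ j ∈ Finset.range (Nat.log 2 T + 1), (2 : ℝ) ^ j ≤ 2 * T := by
    have : (2 : ℝ) ^ Nat.log 2 T ≤ T := by exact_mod_cast Nat.pow_log_le_self 2 (by omega)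
    rw [geom_sum_eq (by norm_num), pow_succ]
    norm_num
    linarith
  rw [lamF, MF_eq_sum_range a b d ψ φ le_rfl,
    MF_eq_sum_range a b d ψ φ (Nat.log_mono_right (Nat.sub_le T 1)), ← Finset.sum_sub_distrib,
    Nat.cast_pred (by omega)]
  refine (Finset.abs_sum_le_sum_abs _ _).trans
    ((Finset.sum_le_sum fun j _ => abs_sub_dyadic_le hs ht₀ hN hD hT' j).trans ?_)
  rw [Finset.sum_add_distrib, ← Finset.mul_sum, ← Finset.mul_sum]
  have hsum := (summable_add_one_rpow_mul_half_pow |e|).sum_le_tsum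
    (Finset.range (Nat.log 2 T + 1)) fun j _ => by positivity
  refine add_le_add ?_ ?_
  · calc _ ≤ (s + |e|) * 2 ^ |e| * ((T : ℝ) ^ (s - 1) * Real.log ((T : ℝ) + 2) ^ e) *
          ∑' j : ℕ, ((j : ℝ) + 1) ^ |e| * (1 / 2) ^ j := by gcongr
      _ = _ := by ring
  · calc _ ≤ 4 * t₀ * D / T * (2 * T) := by gcongr
      _ = _ := by field_simp; ring

lemma exists_muF_bound (a b d : ℕ) {ψ φ : ℝ → ℝ} (hψ : ContinuousOn ψ (Set.Ici 1))
    (hφ : ContinuousOn φ (Set.Ici 1)) (hψ0 : ∀ t, 1 ≤ t → ψ t ≠ 0) (R : ℝ) :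
    ∃ D, ∀ t, t < R → |muF a b d ψ φ t| ≤ D := by
  have hcont : ContinuousOn
      (fun t => (t / ψ t) ^ (a - b) * max 1 ((φ t / ψ t) ^ (d - a))) (Set.Icc 1 R) := by
    have hψ' := hψ.mono (Set.Icc_subset_Ici_self : Set.Icc 1 R ⊆ Set.Ici 1)
    have hφ' := hφ.mono (Set.Icc_subset_Ici_self : Set.Icc 1 R ⊆ Set.Ici 1)
    have h0 : ∀ t ∈ Set.Icc 1 R, ψ t ≠ 0 := fun t ht => hψ0 t ht.1
    exact ((continuousOn_id.div hψ' h0).pow _).mul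
      (continuousOn_const.sup ((hφ'.div hψ' h0).pow _))
  obtain ⟨D, hD⟩ := isCompact_Icc.exists_bound_of_continuousOn hcont
  refine ⟨max D 0, fun t ht => ?_⟩
  rw [muF]
  split_ifs with h1
  · simp
  · exact (hD t ⟨not_lt.1 h1, ht.le⟩).trans (le_max_left _ _)

lemma continuousOn_rpow_mul_log_add_two_rpow (u v : ℝ) :
    ContinuousOn (fun t : ℝ => t ^ u * Real.log (t + 2) ^ v) (Set.Ici 1) := by
  intro t ht
  have ht' : (1 : ℝ) ≤ t := ht
  have hL := one_le_log_add_two ht'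
  refine ContinuousAt.continuousWithinAt (ContinuousAt.mul ?_ ?_)
  · exact Real.continuousAt_rpow_const _ _ (Or.inl (by linarith))
  · refine ContinuousAt.rpow_const ?_ (Or.inl (by linarith))
    exact ContinuousAt.log (by fun_prop) (by linarith)

lemma eventually_rpow_mul_log_le {β γ B₀ C₀ : ℝ} (h : β < γ ∨ β = γ ∧ C₀ ≤ B₀) :
    ∀ᶠ t : ℝ in atTop,
      t ^ (-γ) * Real.log (t + 2) ^ C₀ ≤ t ^ (-β) * Real.log (t + 2) ^ B₀ := by
  rcases h with h | ⟨rfl, h⟩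
  · filter_upwards [(isLittleO_log_add_two_rpow (C₀ - B₀) (sub_pos.2 h)).bound one_pos,
      eventually_ge_atTop 1] with t ht ht1
    have hL := one_le_log_add_two ht1
    have hL0 : 0 < Real.log (t + 2) := by linarith
    rw [Real.norm_of_nonneg (by positivity), Real.norm_of_nonneg (by positivity), one_mul] at ht
    calc _ = t ^ (-γ) * (Real.log (t + 2) ^ (C₀ - B₀) * Real.log (t + 2) ^ B₀) := by
          rw [← Real.rpow_add hL0]; simp
      _ ≤ t ^ (-γ) * (t ^ (γ - β) * Real.log (t + 2) ^ B₀) := by gcongr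
      _ = _ := by
          rw [← mul_assoc, ← Real.rpow_add (by linarith)]
          congr 2; ring
  · filter_upwards [eventually_ge_atTop 1] with t ht1
    have hL := one_le_log_add_two ht1
    gcongr

lemma muF_eq_rpow_mul_log {a b d : ℕ} {φ : ℝ → ℝ} {β B₀ t : ℝ} (ht : 1 ≤ t)
    (hφ0 : 0 ≤ φ t) (hφψ : φ t ≤ t ^ (-β) * Real.log (t + 2) ^ B₀) :
    muF a b d (fun t => t ^ (-β) * Real.log (t + 2) ^ B₀) φ t =
      t ^ ((1 + β) * (a - b : ℕ)) * Real.log (t + 2) ^ (-B₀ * (a - b : ℕ)) := by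
  have hL := one_le_log_add_two ht
  have hL0 : 0 < Real.log (t + 2) := by linarith
  have ht0 : 0 < t := by linarith
  have hq : (φ t / (t ^ (-β) * Real.log (t + 2) ^ B₀)) ^ (d - a) ≤ 1 :=
    pow_le_one₀ (by positivity) ((div_le_one (by positivity)).2 hφψ)
  rw [muF, if_neg (not_lt.2 ht), max_eq_left hq, mul_one, Real.rpow_mul ht0.le,
    Real.rpow_mul hL0.le, Real.rpow_natCast, Real.rpow_natCast, ← mul_pow]
  congr 1
  rw [Real.rpow_add ht0, Real.rpow_one, Real.rpow_neg hL0.le, Real.rpow_neg ht0.le]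
  field_simp

lemma lt_or_eq_and_le_of_convergence_condition {β γ B₀ C₀ p r : ℝ} (hβ : 0 < β) (hβγ : β ≤ γ)
    (hr : 0 < r) (hrp : r ≤ p)
    (h : γ * r > β * p + (p - r) ∨ γ * r = β * p + (p - r) ∧ C₀ * r - B₀ * p < -1) :
    β < γ ∨ β = γ ∧ C₀ ≤ B₀ := by
  rcases hβγ.lt_or_eq with hlt | rfl
  · exact Or.inl hlt
  · refine Or.inr ⟨rfl, ?_⟩
    rcases h with h | ⟨h, hlog⟩
    · nlinarith
    · obtain rfl : r = p := by nlinarith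
      nlinarith

lemma rpow_mul_log_weight_eq {s e γ C₀ T : ℝ} (hT : 1 ≤ T) (r : ℕ) (K₁ K₂ : ℝ) :
    (K₁ * (T ^ (s - 1) * Real.log (T + 2) ^ e) + K₂) *
        ((T ^ (-γ) * Real.log (T + 2) ^ C₀) ^ r / T ^ r) =
      K₁ * (T ^ (s - 1 - (γ + 1) * r) * Real.log (T + 2) ^ (e + C₀ * r)) +
        K₂ * (T ^ (-((γ + 1) * r)) * Real.log (T + 2) ^ (C₀ * r)) := by
  have hT0 : 0 < T := by linarith
  have hL0 : 0 < Real.log (T + 2) := by linarith [one_le_log_add_two hT]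
  have hw : (T ^ (-γ) * Real.log (T + 2) ^ C₀) ^ r / T ^ r =
      T ^ (-((γ + 1) * r)) * Real.log (T + 2) ^ (C₀ * r) := by
    rw [← neg_mul, Real.rpow_mul hL0.le C₀, Real.rpow_mul hT0.le, Real.rpow_natCast,
      Real.rpow_natCast, ← div_pow, ← mul_pow, neg_add, Real.rpow_add hT0, Real.rpow_neg_one]
    congr 1
    ring
  rw [hw, sub_eq_add_neg (s - 1), Real.rpow_add hT0, Real.rpow_add hL0]
  ring

/-- for `1 ≤ b ≤ c < a ≤ d`, `0 < β ≤ γ`, `ψ(T) = T^{−β} log(T+2)^{B₀}` and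
`φ(T) = T^{−γ} log(T+2)^{C₀}`, if `γ(a−c) > β(a−b)+c−b`, or `γ(a−c) = β(a−b)+c−b` and
`C₀(a−c) − B₀(a−b) < −1`, then the series `Σ_T λ_T φ(T)^{a−c}/T^{a−c}` converges. -/
theorem stmt_10 (a b c d : ℕ) (hb : 1 ≤ b) (hbc : b ≤ c) (hca : c < a) (had : a ≤ d)
    (β γ B₀ C₀ : ℝ) (hβpos : 0 < β) (hβγ : β ≤ γ)
    (hcond :
      γ * ((a : ℝ) - (c : ℝ)) > β * ((a : ℝ) - (b : ℝ)) + (c : ℝ) - (b : ℝ) ∨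
      (γ * ((a : ℝ) - (c : ℝ)) = β * ((a : ℝ) - (b : ℝ)) + (c : ℝ) - (b : ℝ) ∧
        C₀ * ((a : ℝ) - (c : ℝ)) - B₀ * ((a : ℝ) - (b : ℝ)) < -1)) :
    Summable (fun T : ℕ =>
      lamF a b d (fun t => t ^ (-β) * Real.log (t + 2) ^ B₀)
          (fun t => t ^ (-γ) * Real.log (t + 2) ^ C₀) T *
        ((T : ℝ) ^ (-γ) * Real.log ((T : ℝ) + 2) ^ C₀) ^ (a - c) / (T : ℝ) ^ (a - c)) := by
  have hp : (1 : ℝ) ≤ (a - b : ℕ) := by exact_mod_cast (by omega : 1 ≤ a - b)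
  have hr : (1 : ℝ) ≤ (a - c : ℕ) := by exact_mod_cast (by omega : 1 ≤ a - c)
  have hrp : ((a - c : ℕ) : ℝ) ≤ (a - b : ℕ) := by exact_mod_cast (by omega : a - c ≤ a - b)
  have hcond' : γ * (a - c : ℕ) > β * (a - b : ℕ) + ((a - b : ℕ) - (a - c : ℕ)) ∨
      γ * (a - c : ℕ) = β * (a - b : ℕ) + ((a - b : ℕ) - (a - c : ℕ)) ∧
        C₀ * (a - c : ℕ) - B₀ * (a - b : ℕ) < -1 := by
    rw [Nat.cast_sub hca.le, Nat.cast_sub (hbc.trans hca.le)]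
    exact hcond.imp (fun h => by linarith) fun h => ⟨by linarith [h.1], h.2⟩
  have hβγ' := lt_or_eq_and_le_of_convergence_condition hβpos hβγ (by linarith) hrp hcond'
  obtain ⟨t₀, ht₀⟩ := eventually_atTop.1
    ((eventually_rpow_mul_log_le hβγ').and (eventually_ge_atTop 1))
  obtain ⟨D, hD⟩ := exists_muF_bound a b d (continuousOn_rpow_mul_log_add_two_rpow (-β) B₀)
    (continuousOn_rpow_mul_log_add_two_rpow (-γ) C₀)
    (fun t ht => by have := one_le_log_add_two ht; positivity) (2 * t₀)
  obtain ⟨K₁, K₂, hK⟩ := exists_abs_lamF_le a b d _ _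
    (s := (1 + β) * (a - b : ℕ)) (e := -B₀ * (a - b : ℕ)) (by nlinarith) (ht₀ t₀ le_rfl).2
    (fun t ht => muF_eq_rpow_mul_log (ht₀ t ht).2
      (by have h1 := (ht₀ t ht).2; have := one_le_log_add_two h1; positivity) (ht₀ t ht).1) hD
  have hs₁ := summable_rpow_mul_log_add_two_rpow
    (u := (1 + β) * (a - b : ℕ) - 1 - (γ + 1) * (a - c : ℕ))
    (v := -B₀ * (a - b : ℕ) + C₀ * (a - c : ℕ))
    (hcond'.imp (fun h => by linarith) fun h => ⟨by linarith [h.1], by linarith [h.2]⟩)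
  have hs₂ := summable_rpow_mul_log_add_two_rpow (u := -((γ + 1) * (a - c : ℕ)))
    (v := C₀ * (a - c : ℕ)) (Or.inl (by nlinarith))
  refine summable_of_isBigO_nat ((hs₁.mul_left K₁).add (hs₂.mul_left K₂))
    (Asymptotics.IsBigO.of_bound' ?_)
  filter_upwards [eventually_ge_atTop 2] with T hT
  have hT1 : (1 : ℝ) ≤ T := by exact_mod_cast one_le_two.trans hT
  have hL := one_le_log_add_two hT1
  rw [← rpow_mul_log_weight_eq hT1, mul_div_assoc, norm_mul, norm_mul]
  exact mul_le_mul_of_nonneg_right ((hK T hT).trans (le_abs_self _)) (norm_nonneg _)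

end
end
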